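/- Let Ω ⊂ ℝ² be a bounded, open, simply connected domain satisfying Assumption (R), and let ψ₀ be the scalar potential of B. Assume there exists a critical point x_sp of ψ₀ (i.e. ∇ψ₀(x_sp) = 0) with ψ_min := inf_Ω ψ₀ < 0 < ψ₀(x_sp) =: ψ_sp. Assume further that ψ₀⁻¹(ψ_sp) contains a C^{2,α} closed simple curve enclosing a nonempty part of ψ₀⁻¹(ψ_min). Then limsup_{h→0⁺} h·log Λ^D(h,B,Ω) ≤ −2·(ψ_sp − ψ_min). -/

import Mathlib

open MeasureTheory Set Filter Topology

noncomputable section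

/-- First partial derivative (in the direction `x₁`) of a function on `ℝ × ℝ`. -/
def pd1 {E : Type*} [NormedAddCommGroup E] [NormedSpace ℝ E] (u : ℝ × ℝ → E) (x : ℝ × ℝ) : E :=
  fderiv ℝ u x (1, 0)

/-- Second partial derivative (in the direction `x₂`) of a function on `ℝ × ℝ`. -/
def pd2 {E : Type*} [NormedAddCommGroup E] [NormedSpace ℝ E] (u : ℝ × ℝ → E) (x : ℝ × ℝ) : E :=
  fderiv ℝ u x (0, 1)

/-- The Laplacian on `ℝ × ℝ`. -/
def lap (ψ : ℝ × ℝ → ℝ) (x : ℝ × ℝ) : ℝ := pd1 (pd1 ψ) x + pd2 (pd2 ψ) x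

/-- Test functions for the Dirichlet variational problems on `Ω`:
nonzero smooth compactly supported functions with support in `Ω`. -/
def IsTestFun (Ω : Set (ℝ × ℝ)) (u : ℝ × ℝ → ℂ) : Prop :=
  ContDiff ℝ (⊤ : ℕ∞) u ∧ HasCompactSupport u ∧ tsupport u ⊆ Ω ∧ u ≠ 0

/-- Rayleigh quotient of the spin-`σ` (`σ = -1` : spin-down, `σ = 1` : spin-up)
Dirichlet Pauli operator at the test function `u`. -/
def pauliRayleigh (σ : ℝ) (h : ℝ) (A : ℝ × ℝ → ℝ × ℝ) (B : ℝ × ℝ → ℝ) (Ω : Set (ℝ × ℝ))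
    (u : ℝ × ℝ → ℂ) : ℝ :=
  ((∫ x in Ω, (‖(h : ℂ) * pd1 u x - Complex.I * ((A x).1 : ℂ) * u x‖ ^ 2
      + ‖(h : ℂ) * pd2 u x - Complex.I * ((A x).2 : ℂ) * u x‖ ^ 2))
    + σ * (h * ∫ x in Ω, B x * ‖u x‖ ^ 2)) / ∫ x in Ω, ‖u x‖ ^ 2

/-- The ground state energy `λ₋^D(h,A,B,Ω)` of the spin-down Dirichlet Pauli operator. -/
def lambdaMinusD (h : ℝ) (A : ℝ × ℝ → ℝ × ℝ) (B : ℝ × ℝ → ℝ) (Ω : Set (ℝ × ℝ)) : ℝ :=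
  sInf (pauliRayleigh (-1) h A B Ω '' {u | IsTestFun Ω u})

/-- The ground state energy `λ₊^D(h,A,B,Ω)` of the spin-up Dirichlet Pauli operator. -/
def lambdaPlusD (h : ℝ) (A : ℝ × ℝ → ℝ × ℝ) (B : ℝ × ℝ → ℝ) (Ω : Set (ℝ × ℝ)) : ℝ :=
  sInf (pauliRayleigh 1 h A B Ω '' {u | IsTestFun Ω u})

/-- The ground state energy `Λ^D(h,A,B,Ω)` of the full Dirichlet Pauli operator. -/
def LambdaD (h : ℝ) (A : ℝ × ℝ → ℝ × ℝ) (B : ℝ × ℝ → ℝ) (Ω : Set (ℝ × ℝ)) : ℝ :=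
  min (lambdaMinusD h A B Ω) (lambdaPlusD h A B Ω)

/-- The canonical vector potential `∇⊥ψ = (−∂₂ψ, ∂₁ψ)`. -/
def perpGrad (ψ : ℝ × ℝ → ℝ) (x : ℝ × ℝ) : ℝ × ℝ := (-(pd2 ψ x), pd1 ψ x)

/-- `ψ` is the scalar potential of `B` on `Ω`: `ψ ∈ C⁰(closure Ω) ∩ C²(Ω)`,
`Δψ = B` in `Ω` and `ψ = 0` on `∂Ω`. -/
structure IsScalarPotential (Ω : Set (ℝ × ℝ)) (B : ℝ × ℝ → ℝ) (ψ : ℝ × ℝ → ℝ) : Prop where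
  contOn : ContinuousOn ψ (closure Ω)
  c2 : ContDiffOn ℝ 2 ψ Ω
  lap_eq : ∀ x ∈ Ω, lap ψ x = B x
  bdry : ∀ x ∈ frontier Ω, ψ x = 0

/-- `A` is a continuous vector potential for `B` on `Ω`: `∂₁A₂ − ∂₂A₁ = B`. -/
def IsVectorPotential (Ω : Set (ℝ × ℝ)) (B : ℝ × ℝ → ℝ) (A : ℝ × ℝ → ℝ × ℝ) : Prop :=
  ContinuousOn A Ω ∧ ∀ x ∈ Ω, pd1 (fun y => (A y).2) x - pd2 (fun y => (A y).1) x = B x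

/-- `γ` is a regular curve of class `C^{2,α}` on the parameter set `s`. -/
def C2HolderOn (α : ℝ) (γ : ℝ → ℝ × ℝ) (s : Set ℝ) : Prop :=
  ContDiffOn ℝ 2 γ s ∧
  (∃ C : ℝ, ∀ x ∈ s, ∀ y ∈ s,
      ‖derivWithin (derivWithin γ s) s x - derivWithin (derivWithin γ s) s y‖ ≤ C * |x - y| ^ α) ∧
  ∀ x ∈ s, derivWithin γ s x ≠ 0

/-- Near `p`, the set `Γ` is a regular curve of class `C^{2,α}`. -/
def IsLocallyC2CurveAt (α : ℝ) (Γ : Set (ℝ × ℝ)) (p : ℝ × ℝ) : Prop :=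
  ∃ ε > 0, ∃ γ : ℝ → ℝ × ℝ, C2HolderOn α γ (Icc (-1) 1) ∧ γ 0 = p ∧
    Γ ∩ Metric.ball p ε = γ '' Ioo (-1) 1 ∩ Metric.ball p ε

/-- `Γ` is (locally) a regular curve of class `C^{2,α}`. -/
def IsC2HolderSet (α : ℝ) (Γ : Set (ℝ × ℝ)) : Prop := ∀ p ∈ Γ, IsLocallyC2CurveAt α Γ p

/-- `Ω` has a corner at `p` formed by two `C^{2,α}` arcs, of aperture less than `π`
(near `p`, `Ω` is contained in a strictly convex open cone with vertex `p`). -/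
def HasConvexCornerAt (Ω : Set (ℝ × ℝ)) (α : ℝ) (p : ℝ × ℝ) : Prop :=
  ∃ ε > 0, (∃ γ₁ γ₂ : ℝ → ℝ × ℝ, C2HolderOn α γ₁ (Icc 0 1) ∧ C2HolderOn α γ₂ (Icc 0 1) ∧
      γ₁ 0 = p ∧ γ₂ 0 = p ∧
      frontier Ω ∩ Metric.ball p ε = (γ₁ '' Ico 0 1 ∪ γ₂ '' Ico 0 1) ∩ Metric.ball p ε) ∧
    ∃ w : ℝ × ℝ, ∃ c > 0, ∀ x ∈ Ω ∩ Metric.ball p ε,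
      c * ‖x - p‖ ≤ (x - p).1 * w.1 + (x - p).2 * w.2

/-- `Ω` has a continuous boundary which is piecewise of class `C^{2,α}` for some `α > 0`,
with at most finitely many corners, each of aperture less than `π`. -/
def HasPiecewiseC2Boundary (Ω : Set (ℝ × ℝ)) : Prop :=
  ∃ α > 0, ∃ S : Finset (ℝ × ℝ), ↑S ⊆ frontier Ω ∧
    (∀ p ∈ frontier Ω \ (S : Set (ℝ × ℝ)), IsLocallyC2CurveAt α (frontier Ω) p) ∧
    ∀ p ∈ S, HasConvexCornerAt Ω α p

/-- Assumption (R): `Ω` is bounded and open with continuous, piecewise `C^{2,α}` boundary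
having finitely many corners of aperture `< π`, and `B` extends continuously to `closure Ω`. -/
structure AssumptionR (Ω : Set (ℝ × ℝ)) (B : ℝ × ℝ → ℝ) : Prop where
  isOpen : IsOpen Ω
  bounded : Bornology.IsBounded Ω
  bdryReg : HasPiecewiseC2Boundary Ω
  fieldCont : ContinuousOn B (closure Ω)

/-- The oscillation of `ψ` over `Ω`. -/
def osc (ψ : ℝ × ℝ → ℝ) (Ω : Set (ℝ × ℝ)) : ℝ := sSup (ψ '' Ω) - sInf (ψ '' Ω)

/-- The region enclosed by `Γ`: the union of the bounded connected components of `Γᶜ`. -/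
def curveInterior (Γ : Set (ℝ × ℝ)) : Set (ℝ × ℝ) :=
  {x | x ∉ Γ ∧ Bornology.IsBounded (connectedComponentIn Γᶜ x)}

/-- `Γ` is a simple closed curve of class `C^{2,α}`. -/
def IsC2ClosedCurve (α : ℝ) (Γ : Set (ℝ × ℝ)) : Prop :=
  ∃ γ : ℝ → ℝ × ℝ, Function.Periodic γ 1 ∧ C2HolderOn α γ (Icc 0 1) ∧
    InjOn γ (Ico 0 1) ∧ Γ = γ '' Icc 0 1

/-- The ground state energy `λ^D(Ω)` of the Dirichlet Laplacian on `Ω`. -/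
def dirichletGSE (Ω : Set (ℝ × ℝ)) : ℝ :=
  sInf ((fun u : ℝ × ℝ → ℝ =>
      (∫ x in Ω, (pd1 u x ^ 2 + pd2 u x ^ 2)) / ∫ x in Ω, u x ^ 2) ''
    {u | ContDiff ℝ (⊤ : ℕ∞) u ∧ HasCompactSupport u ∧ tsupport u ⊆ Ω ∧ u ≠ 0})

/-- The open disc of radius `R` centred at the origin (with the Euclidean distance). -/
def disc (R : ℝ) : Set (ℝ × ℝ) := {y : ℝ × ℝ | y.1 ^ 2 + y.2 ^ 2 < R ^ 2}

end

/-- The identification of `ℝ × ℝ` with `ℂ`. -/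
noncomputable def toComplex (z : ℝ × ℝ) : ℂ := z.1 + z.2 * Complex.I

lemma continuous_toComplex : Continuous toComplex := by
  unfold toComplex
  fun_prop

lemma toComplex_injective : Function.Injective toComplex := by
  intro z w h
  have h1 := congrArg Complex.re h
  have h2 := congrArg Complex.im h
  simp only [toComplex, Complex.add_re, Complex.ofReal_re, Complex.mul_re, Complex.I_re, mul_zero,
    Complex.ofReal_im, Complex.I_im, mul_one, sub_self, add_zero, Complex.add_im, Complex.mul_im,
    zero_add] at h1 h2
  exact Prod.ext h1 h2

/-- If `p` belongs to a bounded plane set `U`, then `z - p` has no continuous logarithm on the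
frontier of `U`. -/
lemma not_exists_log_on_frontier {U : Set (ℝ × ℝ)} (hUb : Bornology.IsBounded U)
    {p : ℝ × ℝ} (hp : p ∈ U) {g : ℝ × ℝ → ℂ} (hg : ContinuousOn g (frontier U))
    (hgp : ∀ z ∈ frontier U, Complex.exp (g z) = toComplex z - toComplex p) : False := by
  classical
  obtain ⟨G, hG⟩ := ContinuousMap.exists_restrict_eq (isClosed_frontier (s := U))
    ⟨(frontier U).domRestrict g, continuousOn_iff_continuous_domRestrict.mp hg⟩
  have hGg : ∀ z ∈ frontier U, G z = g z := fun z hz => DFunLike.congr_fun hG ⟨z, hz⟩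
  set f : ℝ × ℝ → ℂ :=
    U.piecewise (fun z => Complex.exp (G z)) (fun z => toComplex z - toComplex p) with hf
  have hfc : Continuous f := by
    refine Continuous.piecewise (fun z hz => ?_) (by fun_prop)
      (continuous_toComplex.sub continuous_const)
    rw [hGg z hz, hgp z hz]
  have hf0 : ∀ z, f z ≠ 0 := by
    intro z
    by_cases hz : z ∈ U
    · simp [hf, hz]
    · simp only [hf, piecewise_eq_of_notMem _ _ _ hz]
      intro h
      exact hz (toComplex_injective (sub_eq_zero.1 h) ▸ hp)
  obtain ⟨L, hLc, hL⟩ := Complex.exists_continuousOn_eqOn_exp_comp (X := ℝ × ℝ) (U := univ)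
    (g := f) (by
      have : SimplyConnectedSpace (univ : Set (ℝ × ℝ)) :=
        (Homeomorph.Set.univ (ℝ × ℝ)).toHomotopyEquiv.simplyConnectedSpace
      exact this) isOpen_univ hfc.continuousOn (by simpa using hf0)
  rw [continuousOn_univ] at hLc
  obtain ⟨R, hR⟩ := hUb.exists_norm_le
  obtain ⟨r, hr0, hr⟩ : ∃ r : ℝ, 0 < r ∧ ∀ t : ℝ,
      p + (r * Real.cos t, r * Real.sin t) ∉ U := by
    refine ⟨2 * (|R| + ‖p‖ + 1), by positivity, fun t ht => ?_⟩
    have h1 := hR _ ht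
    set r := 2 * (|R| + ‖p‖ + 1) with hrdef
    have h2 : ‖((r * Real.cos t, r * Real.sin t) : ℝ × ℝ)‖ ≤ |R| + ‖p‖ := by
      calc _ = ‖(p + (r * Real.cos t, r * Real.sin t)) - p‖ := by rw [add_sub_cancel_left]
        _ ≤ _ := (norm_sub_le _ _).trans (by gcongr; exact h1.trans (le_abs_self R))
    have h3 := (norm_fst_le _).trans h2
    have h4 := (norm_snd_le _).trans h2
    simp only [Real.norm_eq_abs] at h3 h4
    have h5 := sq_le_sq' (abs_le.1 h3).1 (abs_le.1 h3).2
    have h6 := sq_le_sq' (abs_le.1 h4).1 (abs_le.1 h4).2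
    have h7 := Real.sin_sq_add_cos_sq t
    have h8 : r ^ 2 ≤ 2 * (|R| + ‖p‖) ^ 2 := by nlinarith
    have : 0 ≤ |R| + ‖p‖ := by positivity
    rw [hrdef] at h8
    nlinarith
  set q : ℝ → ℝ × ℝ := fun t => p + (r * Real.cos t, r * Real.sin t) with hq
  have hqc : Continuous q := by fun_prop
  have hLq : ∀ t, Complex.exp (L (q t)) = Complex.exp (Real.log r + t * Complex.I) := by
    intro t
    have h1 : Complex.exp (L (q t)) = f (q t) := hL (mem_univ _)
    rw [h1, Complex.exp_add, ← Complex.ofReal_exp, Real.exp_log hr0, Complex.exp_mul_I]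
    have h2 : q t ∉ U := hr t
    simp only [hf, piecewise_eq_of_notMem _ _ _ h2]
    simp only [hq, toComplex, Prod.fst_add, Prod.snd_add]
    push_cast
    ring
  set m : ℝ → ℝ := fun t => ((L (q t) - (Real.log r + t * Complex.I)).im) / (2 * Real.pi)
  have hm : ∀ t, ∃ n : ℤ, m t = n := by
    intro t
    obtain ⟨n, hn⟩ := Complex.exp_eq_exp_iff_exists_int.1 (hLq t)
    refine ⟨n, ?_⟩
    simp only [m, hn]
    have := Real.pi_pos
    simp only [add_sub_cancel_left, Complex.mul_im, Complex.intCast_re, Complex.intCast_im,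
      Complex.mul_re, Complex.I_im, Complex.I_re, Complex.re_ofNat, Complex.im_ofNat,
      Complex.ofReal_re, Complex.ofReal_im]
    field_simp
    ring
  have hmc : Continuous m := by fun_prop
  have hconst : m 0 = m (2 * Real.pi) := by
    choose n hn using hm
    have hnc : Continuous n := by
      rw [Int.isClosedEmbedding_coe_real.isEmbedding.continuous_iff]
      convert hmc using 1
      ext t; simp [hn]
    rw [hn, hn, PreconnectedSpace.constant inferInstance hnc]
  have hq2 : q (2 * Real.pi) = q 0 := by simp [hq]
  have := Real.pi_pos
  simp only [m, hq2] at hconst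
  field_simp at hconst
  simp at hconst
  linarith

/-- A bounded plane set whose frontier lies in a simply connected open set `Ω` is contained
in `Ω`. -/
lemma subset_of_frontier_subset {Ω U : Set (ℝ × ℝ)} (hΩo : IsOpen Ω)
    (hsc : SimplyConnectedSpace Ω) (hUb : Bornology.IsBounded U)
    (hU : frontier U ⊆ Ω) : U ⊆ Ω := by
  intro p hp
  by_contra hpΩ
  obtain ⟨L, hLc, hL⟩ := Complex.exists_continuousOn_eqOn_exp_comp (X := ℝ × ℝ) (U := Ω)
    (g := fun z => toComplex z - toComplex p) hsc hΩo
    (continuous_toComplex.sub continuous_const).continuousOn (by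
      rintro ⟨z, hz, h⟩
      exact hpΩ (toComplex_injective (sub_eq_zero.1 h) ▸ hz))
  exact not_exists_log_on_frontier hUb hp (hLc.mono hU) fun z hz => hL (hU hz)

lemma frontier_connectedComponentIn_subset {Γ : Set (ℝ × ℝ)} (hΓ : IsClosed Γ) (x : ℝ × ℝ) :
    frontier (connectedComponentIn Γᶜ x) ⊆ Γ := by
  intro y hy
  by_contra hyΓ
  have hyo : IsOpen (connectedComponentIn Γᶜ y) := hΓ.isOpen_compl.connectedComponentIn
  have hxo : IsOpen (connectedComponentIn Γᶜ x) := hΓ.isOpen_compl.connectedComponentIn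
  have hyy : y ∈ connectedComponentIn Γᶜ y := mem_connectedComponentIn hyΓ
  rw [hxo.frontier_eq] at hy
  obtain ⟨z, hzy, hzx⟩ := mem_closure_iff.1 hy.1 _ hyo hyy
  have := (connectedComponentIn_eq hzx).trans (connectedComponentIn_eq hzy).symm
  exact hy.2 (this ▸ hyy)

section Support

variable {E : Type*} [NormedAddCommGroup E] {Ω K : Set (ℝ × ℝ)}

lemma continuous_of_eq_zero_off (hΩ : IsOpen Ω) (hK : IsClosed K) (hKΩ : K ⊆ Ω)
    {f : ℝ × ℝ → E} (hf : ContinuousOn f Ω) (h0 : ∀ x ∉ K, f x = 0) : Continuous f := by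
  rw [continuous_iff_continuousAt]
  intro x
  by_cases hx : x ∈ K
  · exact hf.continuousAt (hΩ.mem_nhds (hKΩ hx))
  · refine (continuousAt_const (y := (0 : E))).congr ?_
    filter_upwards [hK.isOpen_compl.mem_nhds hx] with y hy using (h0 y hy).symm

lemma contDiff_of_eq_zero_off [NormedSpace ℝ E] {n : WithTop ℕ∞} (hΩ : IsOpen Ω)
    (hK : IsClosed K) (hKΩ : K ⊆ Ω)
    {f : ℝ × ℝ → E} (hf : ContDiffOn ℝ n f Ω) (h0 : ∀ x ∉ K, f x = 0) : ContDiff ℝ n f := by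
  rw [contDiff_iff_contDiffAt]
  intro x
  by_cases hx : x ∈ K
  · exact hf.contDiffAt (hΩ.mem_nhds (hKΩ hx))
  · refine (contDiffAt_const (c := (0 : E))).congr_of_eventuallyEq ?_
    filter_upwards [hK.isOpen_compl.mem_nhds hx] with y hy using h0 y hy

lemma integrable_of_eq_zero_off (hΩ : IsOpen Ω) (hK : IsCompact K) (hKΩ : K ⊆ Ω)
    {f : ℝ × ℝ → E} (hf : ContinuousOn f Ω) (h0 : ∀ x ∉ K, f x = 0) : Integrable f :=
  (continuous_of_eq_zero_off hΩ hK.isClosed hKΩ hf h0).integrable_of_hasCompactSupport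
    (HasCompactSupport.intro hK h0)

end Support

section Derivatives

variable {E : Type*} [NormedAddCommGroup E] [NormedSpace ℝ E]

lemma pd1_of_notMem_tsupport {u : ℝ × ℝ → E} {x : ℝ × ℝ} (hx : x ∉ tsupport u) : pd1 u x = 0 := by
  simp [pd1, fderiv_of_notMem_tsupport ℝ hx]

lemma pd2_of_notMem_tsupport {u : ℝ × ℝ → E} {x : ℝ × ℝ} (hx : x ∉ tsupport u) : pd2 u x = 0 := by
  simp [pd2, fderiv_of_notMem_tsupport ℝ hx]

lemma norm_pd1_le (u : ℝ × ℝ → E) (x : ℝ × ℝ) : ‖pd1 u x‖ ≤ ‖fderiv ℝ u x‖ := by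
  simpa [pd1, Prod.norm_def] using (fderiv ℝ u x).le_opNorm (1, 0)

lemma norm_pd2_le (u : ℝ × ℝ → E) (x : ℝ × ℝ) : ‖pd2 u x‖ ≤ ‖fderiv ℝ u x‖ := by
  simpa [pd2, Prod.norm_def] using (fderiv ℝ u x).le_opNorm (0, 1)

lemma contDiffOn_pd1 {Ω : Set (ℝ × ℝ)} (hΩ : IsOpen Ω) {m n : WithTop ℕ∞} (hmn : m + 1 ≤ n)
    {u : ℝ × ℝ → E} (hu : ContDiffOn ℝ n u Ω) : ContDiffOn ℝ m (pd1 u) Ω :=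
  (hu.fderiv_of_isOpen hΩ hmn).clm_apply contDiffOn_const

lemma contDiffOn_pd2 {Ω : Set (ℝ × ℝ)} (hΩ : IsOpen Ω) {m n : WithTop ℕ∞} (hmn : m + 1 ≤ n)
    {u : ℝ × ℝ → E} (hu : ContDiffOn ℝ n u Ω) : ContDiffOn ℝ m (pd2 u) Ω :=
  (hu.fderiv_of_isOpen hΩ hmn).clm_apply contDiffOn_const

lemma pd1_pd2_comm {u : ℝ × ℝ → E} {x : ℝ × ℝ} (hu : ContDiffAt ℝ 2 u x) :
    pd1 (pd2 u) x = pd2 (pd1 u) x := by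
  have hd : DifferentiableAt ℝ (fderiv ℝ u) x :=
    (hu.fderiv_right (m := 1) (by norm_num)).differentiableAt (by norm_num)
  have hsym := hu.isSymmSndFDerivAt (by simp)
  unfold pd1 pd2
  rw [fderiv_clm_apply hd (differentiableAt_const _), fderiv_clm_apply hd (differentiableAt_const _)]
  simpa using hsym (1, 0) (0, 1)

lemma pd1_mul {f g : ℝ × ℝ → ℝ} {x : ℝ × ℝ} (hf : DifferentiableAt ℝ f x)
    (hg : DifferentiableAt ℝ g x) :
    pd1 (fun y => f y * g y) x = f x * pd1 g x + g x * pd1 f x := by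
  simp [pd1, fderiv_fun_mul hf hg]

lemma pd2_mul {f g : ℝ × ℝ → ℝ} {x : ℝ × ℝ} (hf : DifferentiableAt ℝ f x)
    (hg : DifferentiableAt ℝ g x) :
    pd2 (fun y => f y * g y) x = f x * pd2 g x + g x * pd2 f x := by
  simp [pd2, fderiv_fun_mul hf hg]

lemma pd1_add {f g : ℝ × ℝ → ℝ} {x : ℝ × ℝ} (hf : DifferentiableAt ℝ f x)
    (hg : DifferentiableAt ℝ g x) :
    pd1 (fun y => f y + g y) x = pd1 f x + pd1 g x := by
  simp [pd1, fderiv_fun_add hf hg]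

lemma pd2_add {f g : ℝ × ℝ → ℝ} {x : ℝ × ℝ} (hf : DifferentiableAt ℝ f x)
    (hg : DifferentiableAt ℝ g x) :
    pd2 (fun y => f y + g y) x = pd2 f x + pd2 g x := by
  simp [pd2, fderiv_fun_add hf hg]

lemma pd1_const_mul {f : ℝ × ℝ → ℝ} {x : ℝ × ℝ} (c : ℝ) (hf : DifferentiableAt ℝ f x) :
    pd1 (fun y => c * f y) x = c * pd1 f x := by
  simp [pd1, fderiv_const_mul hf]

lemma pd2_const_mul {f : ℝ × ℝ → ℝ} {x : ℝ × ℝ} (c : ℝ) (hf : DifferentiableAt ℝ f x) :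
    pd2 (fun y => c * f y) x = c * pd2 f x := by
  simp [pd2, fderiv_const_mul hf]

lemma pd1_re {u : ℝ × ℝ → ℂ} {x : ℝ × ℝ} (hu : DifferentiableAt ℝ u x) :
    pd1 (fun y => (u y).re) x = (pd1 u x).re := by
  exact congrArg (fun L => L (1, 0)) (Complex.reCLM.hasFDerivAt.comp x hu.hasFDerivAt).fderiv

lemma pd2_re {u : ℝ × ℝ → ℂ} {x : ℝ × ℝ} (hu : DifferentiableAt ℝ u x) :
    pd2 (fun y => (u y).re) x = (pd2 u x).re := by
  exact congrArg (fun L => L (0, 1)) (Complex.reCLM.hasFDerivAt.comp x hu.hasFDerivAt).fderiv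

lemma pd1_im {u : ℝ × ℝ → ℂ} {x : ℝ × ℝ} (hu : DifferentiableAt ℝ u x) :
    pd1 (fun y => (u y).im) x = (pd1 u x).im := by
  exact congrArg (fun L => L (1, 0)) (Complex.imCLM.hasFDerivAt.comp x hu.hasFDerivAt).fderiv

lemma pd2_im {u : ℝ × ℝ → ℂ} {x : ℝ × ℝ} (hu : DifferentiableAt ℝ u x) :
    pd2 (fun y => (u y).im) x = (pd2 u x).im := by
  exact congrArg (fun L => L (0, 1)) (Complex.imCLM.hasFDerivAt.comp x hu.hasFDerivAt).fderiv

lemma integral_fderiv_apply_eq_zero {f : ℝ × ℝ → ℝ} (hf : ContDiff ℝ 1 f)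
    (hc : HasCompactSupport f) (v : ℝ × ℝ) : ∫ x, fderiv ℝ f x v = 0 := by
  have hi : Integrable (fun x => fderiv ℝ f x v) :=
    ((hf.continuous_fderiv (by norm_num)).clm_apply
      continuous_const).integrable_of_hasCompactSupport (hc.fderiv_apply ℝ v)
  have := integral_mul_fderiv_eq_neg_fderiv_mul_of_integrable (μ := volume)
    (f := fun _ : ℝ × ℝ => (1 : ℝ)) (g := f) (v := v) (by simp) (by simpa using hi)
    (by simpa using hf.continuous.integrable_of_hasCompactSupport hc)
    (fun _ _ => differentiableAt_const _)
    (fun x _ => (hf.differentiable (by norm_num)) x)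
  simpa using this

end Derivatives

/-- The first order operator `(h∂₁ - iA₁) + s i (h∂₂ - iA₂)` with `A = ∇⊥ψ`. -/
noncomputable def pauliDirac (s h : ℝ) (ψ : ℝ × ℝ → ℝ) (u : ℝ × ℝ → ℂ) (x : ℝ × ℝ) : ℂ :=
  ((h : ℂ) * pd1 u x - Complex.I * ((perpGrad ψ x).1 : ℂ) * u x)
    + s * Complex.I * ((h : ℂ) * pd2 u x - Complex.I * ((perpGrad ψ x).2 : ℂ) * u x)

section Identity

variable {Ω : Set (ℝ × ℝ)} {ψ : ℝ × ℝ → ℝ} {u : ℝ × ℝ → ℂ}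

lemma continuousOn_pauliDirac (hΩ : IsOpen Ω) (hψ : ContDiffOn ℝ 1 ψ Ω) (hu : ContDiffOn ℝ 1 u Ω)
    (s h : ℝ) : ContinuousOn (pauliDirac s h ψ u) Ω := by
  have h1 := (contDiffOn_pd1 (m := 0) hΩ (by norm_num) hψ).continuousOn
  have h2 := (contDiffOn_pd2 (m := 0) hΩ (by norm_num) hψ).continuousOn
  have h3 := (contDiffOn_pd1 (m := 0) hΩ (by norm_num) hu).continuousOn
  have h4 := (contDiffOn_pd2 (m := 0) hΩ (by norm_num) hu).continuousOn
  have h5 := hu.continuousOn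
  unfold pauliDirac perpGrad
  fun_prop

lemma pauliDirac_of_notMem_tsupport {s h : ℝ} {x : ℝ × ℝ} (hx : x ∉ tsupport u) :
    pauliDirac s h ψ u x = 0 := by
  simp [pauliDirac, pd1_of_notMem_tsupport hx, pd2_of_notMem_tsupport hx,
    image_eq_zero_of_notMem_tsupport hx]

/-- The pointwise identity behind the factorization of the Pauli operator: the two quadratic forms
differ by a divergence. -/
lemma sq_norm_pauliDirac {s h : ℝ} (hs : s ^ 2 = 1) {x : ℝ × ℝ} (hψ : ContDiffAt ℝ 2 ψ x)
    (hu : ContDiffAt ℝ 2 u x) :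
    ‖pauliDirac s h ψ u x‖ ^ 2 =
      (‖(h : ℂ) * pd1 u x - Complex.I * ((perpGrad ψ x).1 : ℂ) * u x‖ ^ 2
        + ‖(h : ℂ) * pd2 u x - Complex.I * ((perpGrad ψ x).2 : ℂ) * u x‖ ^ 2)
      - s * h * (lap ψ x * ‖u x‖ ^ 2)
      + pd1 (fun y => (-(2 * s * h ^ 2)) * ((u y).re * (pd2 u y).im)
          + s * h * (pd1 ψ y * ((u y).re * (u y).re + (u y).im * (u y).im))) x
      + pd2 (fun y => (2 * s * h ^ 2) * ((u y).re * (pd1 u y).im)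
          + s * h * (pd2 ψ y * ((u y).re * (u y).re + (u y).im * (u y).im))) x := by
  have hud : DifferentiableAt ℝ u x := hu.differentiableAt (by norm_num)
  have hre : DifferentiableAt ℝ (fun y => (u y).re) x := Complex.reCLM.differentiableAt.comp x hud
  have him : DifferentiableAt ℝ (fun y => (u y).im) x := Complex.imCLM.differentiableAt.comp x hud
  have hfu := (hu.fderiv_right (m := 1) (by norm_num)).differentiableAt (by norm_num)
  have hfψ := (hψ.fderiv_right (m := 1) (by norm_num)).differentiableAt (by norm_num)
  have hu1 : DifferentiableAt ℝ (pd1 u) x := hfu.clm_apply (differentiableAt_const _)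
  have hu2 : DifferentiableAt ℝ (pd2 u) x := hfu.clm_apply (differentiableAt_const _)
  have hψ1 : DifferentiableAt ℝ (pd1 ψ) x := hfψ.clm_apply (differentiableAt_const _)
  have hψ2 : DifferentiableAt ℝ (pd2 ψ) x := hfψ.clm_apply (differentiableAt_const _)
  have hu1i : DifferentiableAt ℝ (fun y => (pd1 u y).im) x :=
    Complex.imCLM.differentiableAt.comp x hu1
  have hu2i : DifferentiableAt ℝ (fun y => (pd2 u y).im) x :=
    Complex.imCLM.differentiableAt.comp x hu2
  rw [pd1_add (by fun_prop) (by fun_prop), pd2_add (by fun_prop) (by fun_prop),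
    pd1_const_mul (-(2 * s * h ^ 2)) (by fun_prop), pd1_const_mul (s * h) (by fun_prop),
    pd2_const_mul (2 * s * h ^ 2) (by fun_prop), pd2_const_mul (s * h) (by fun_prop),
    pd1_mul hre hu2i, pd2_mul hre hu1i, pd1_mul hψ1 (by fun_prop), pd2_mul hψ2 (by fun_prop),
    pd1_add (by fun_prop) (by fun_prop), pd2_add (by fun_prop) (by fun_prop),
    pd1_mul hre hre, pd1_mul him him, pd2_mul hre hre, pd2_mul him him,
    pd1_re hud, pd2_re hud, pd1_im hud, pd2_im hud, pd1_im hu2, pd2_im hu1, pd1_pd2_comm hu]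
  simp only [pauliDirac, perpGrad, lap, Complex.sq_norm, Complex.normSq_apply,
    Complex.add_re, Complex.add_im, Complex.sub_re, Complex.sub_im, Complex.mul_re, Complex.mul_im,
    Complex.ofReal_re, Complex.ofReal_im, Complex.I_re, Complex.I_im, Complex.ofReal_neg,
    Complex.neg_re, Complex.neg_im]
  ring_nf
  simp only [hs]
  ring

lemma integral_sq_norm_pauliDirac (hΩ : IsOpen Ω) (hψ : ContDiffOn ℝ 2 ψ Ω)
    (hu : ContDiff ℝ 2 u) (hc : HasCompactSupport u) (hsupp : tsupport u ⊆ Ω) {s h : ℝ}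
    (hs : s ^ 2 = 1) :
    ∫ x, ‖pauliDirac s h ψ u x‖ ^ 2 =
      (∫ x, (‖(h : ℂ) * pd1 u x - Complex.I * ((perpGrad ψ x).1 : ℂ) * u x‖ ^ 2
        + ‖(h : ℂ) * pd2 u x - Complex.I * ((perpGrad ψ x).2 : ℂ) * u x‖ ^ 2))
      - s * h * ∫ x, lap ψ x * ‖u x‖ ^ 2 := by
  set F : ℝ × ℝ → ℝ := fun y => (-(2 * s * h ^ 2)) * ((u y).re * (pd2 u y).im)
          + s * h * (pd1 ψ y * ((u y).re * (u y).re + (u y).im * (u y).im)) with hF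
  set G : ℝ × ℝ → ℝ := fun y => (2 * s * h ^ 2) * ((u y).re * (pd1 u y).im)
          + s * h * (pd2 ψ y * ((u y).re * (u y).re + (u y).im * (u y).im)) with hG
  have hψ1 : ContDiffOn ℝ 1 (pd1 ψ) Ω := contDiffOn_pd1 hΩ (by norm_num) hψ
  have hψ2 : ContDiffOn ℝ 1 (pd2 ψ) Ω := contDiffOn_pd2 hΩ (by norm_num) hψ
  have hu1 : ContDiffOn ℝ 1 (pd1 u) Ω := contDiffOn_pd1 hΩ (by norm_num) hu.contDiffOn
  have hu2 : ContDiffOn ℝ 1 (pd2 u) Ω := contDiffOn_pd2 hΩ (by norm_num) hu.contDiffOn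
  have hu1i : ContDiffOn ℝ 1 (fun y => (pd1 u y).im) Ω := Complex.imCLM.contDiff.comp_contDiffOn hu1
  have hu2i : ContDiffOn ℝ 1 (fun y => (pd2 u y).im) Ω := Complex.imCLM.contDiff.comp_contDiffOn hu2
  have hu' : ContDiff ℝ 1 u := hu.of_le (by norm_num)
  have hre : ContDiffOn ℝ 1 (fun y => (u y).re) Ω :=
    (Complex.reCLM.contDiff.comp hu').contDiffOn
  have him : ContDiffOn ℝ 1 (fun y => (u y).im) Ω :=
    (Complex.imCLM.contDiff.comp hu').contDiffOn
  have hlap : ContinuousOn (lap ψ) Ω :=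
    ((contDiffOn_pd1 (m := 0) hΩ (by norm_num) hψ1).continuousOn).add
      (contDiffOn_pd2 (m := 0) hΩ (by norm_num) hψ2).continuousOn
  have hu0 : ∀ x ∉ tsupport u, u x = 0 := fun x hx => image_eq_zero_of_notMem_tsupport hx
  have hF0 : ∀ x ∉ tsupport u, F x = 0 := fun x hx => by simp [hF, hu0 x hx]
  have hG0 : ∀ x ∉ tsupport u, G x = 0 := fun x hx => by simp [hG, hu0 x hx]
  have hFc : ContDiff ℝ 1 F := contDiff_of_eq_zero_off hΩ (isClosed_tsupport u) hsupp
    ((contDiffOn_const.mul (hre.mul hu2i)).add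
      (contDiffOn_const.mul (hψ1.mul ((hre.mul hre).add (him.mul him))))) hF0
  have hGc : ContDiff ℝ 1 G := contDiff_of_eq_zero_off hΩ (isClosed_tsupport u) hsupp
    ((contDiffOn_const.mul (hre.mul hu1i)).add
      (contDiffOn_const.mul (hψ2.mul ((hre.mul hre).add (him.mul him))))) hG0
  have hFs : HasCompactSupport F := HasCompactSupport.intro hc hF0
  have hGs : HasCompactSupport G := HasCompactSupport.intro hc hG0
  have hFi : Integrable (pd1 F) := ((hFc.continuous_fderiv (by norm_num)).clm_apply
      continuous_const).integrable_of_hasCompactSupport (hFs.fderiv_apply ℝ _)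
  have hGi : Integrable (pd2 G) := ((hGc.continuous_fderiv (by norm_num)).clm_apply
      continuous_const).integrable_of_hasCompactSupport (hGs.fderiv_apply ℝ _)
  have hF_int : ∫ x, pd1 F x = 0 := integral_fderiv_apply_eq_zero hFc hFs _
  have hG_int : ∫ x, pd2 G x = 0 := integral_fderiv_apply_eq_zero hGc hGs _
  have hE : Integrable (fun x =>
      (‖(h : ℂ) * pd1 u x - Complex.I * ((perpGrad ψ x).1 : ℂ) * u x‖ ^ 2
        + ‖(h : ℂ) * pd2 u x - Complex.I * ((perpGrad ψ x).2 : ℂ) * u x‖ ^ 2)) := by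
    refine integrable_of_eq_zero_off hΩ hc hsupp ?_ fun x hx => by
      simp [pd1_of_notMem_tsupport hx, pd2_of_notMem_tsupport hx, hu0 x hx]
    have h1 := hψ1.continuousOn
    have h2 := hψ2.continuousOn
    have h3 := hu1.continuousOn
    have h4 := hu2.continuousOn
    have h5 := hu.continuous.continuousOn (s := Ω)
    unfold perpGrad
    fun_prop
  have hB : Integrable (fun x => lap ψ x * ‖u x‖ ^ 2) :=
    integrable_of_eq_zero_off hΩ hc hsupp (hlap.mul (hu.continuous.norm.pow 2).continuousOn)
      fun x hx => by simp [hu0 x hx]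
  have hpt : ∀ x, ‖pauliDirac s h ψ u x‖ ^ 2 =
      (‖(h : ℂ) * pd1 u x - Complex.I * ((perpGrad ψ x).1 : ℂ) * u x‖ ^ 2
        + ‖(h : ℂ) * pd2 u x - Complex.I * ((perpGrad ψ x).2 : ℂ) * u x‖ ^ 2)
      - s * h * (lap ψ x * ‖u x‖ ^ 2) + pd1 F x + pd2 G x := by
    intro x
    by_cases hx : x ∈ tsupport u
    · exact sq_norm_pauliDirac hs (hψ.contDiffAt (hΩ.mem_nhds (hsupp hx))) hu.contDiffAt
    · have h1 : x ∉ tsupport F := fun h' => hx (closure_minimal (fun y hy => by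
        by_contra hy'; exact hy (hF0 y hy')) (isClosed_tsupport u) h')
      have h2 : x ∉ tsupport G := fun h' => hx (closure_minimal (fun y hy => by
        by_contra hy'; exact hy (hG0 y hy')) (isClosed_tsupport u) h')
      simp [pauliDirac_of_notMem_tsupport hx, pd1_of_notMem_tsupport hx, hu0 x hx,
        pd2_of_notMem_tsupport hx, pd1_of_notMem_tsupport h1, pd2_of_notMem_tsupport h2]
  simp_rw [hpt]
  rw [integral_add, integral_add, integral_sub, hF_int, hG_int, integral_const_mul]
  · ring
  all_goals fun_prop

end Identity

/-- A Poincaré inequality for functions supported in a ball. -/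
lemma poincare_pd1 {w : ℝ × ℝ → ℂ} (hw : ContDiff ℝ 1 w) (hc : HasCompactSupport w) {R : ℝ}
    (hR : ∀ x ∈ tsupport w, ‖x‖ ≤ R) :
    ∫ x, ‖w x‖ ^ 2 ≤ 4 * R ^ 2 * ∫ x, ‖pd1 w x‖ ^ 2 := by
  set F : ℝ × ℝ → ℝ := fun y => y.1 * ((w y).re * (w y).re + (w y).im * (w y).im) with hF
  have hre : ContDiff ℝ 1 (fun y => (w y).re) := Complex.reCLM.contDiff.comp hw
  have him : ContDiff ℝ 1 (fun y => (w y).im) := Complex.imCLM.contDiff.comp hw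
  have hFc : ContDiff ℝ 1 F := contDiff_fst.mul ((hre.mul hre).add (him.mul him))
  have hFs : HasCompactSupport F := HasCompactSupport.intro hc fun x hx => by
    simp [hF, image_eq_zero_of_notMem_tsupport hx]
  have hFi : Integrable (pd1 F) := ((hFc.continuous_fderiv (by norm_num)).clm_apply
      continuous_const).integrable_of_hasCompactSupport (hFs.fderiv_apply ℝ _)
  have hF_int : ∫ x, pd1 F x = 0 := integral_fderiv_apply_eq_zero hFc hFs _
  have hw1 : Continuous (pd1 w) :=
    (hw.continuous_fderiv (by norm_num)).clm_apply continuous_const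
  have hwi : Integrable (fun x => ‖w x‖ ^ 2) :=
    (hw.continuous.norm.pow 2).integrable_of_hasCompactSupport
      (HasCompactSupport.intro hc fun x hx => by simp [image_eq_zero_of_notMem_tsupport hx])
  have hw1i : Integrable (fun x => ‖pd1 w x‖ ^ 2) :=
    (hw1.norm.pow 2).integrable_of_hasCompactSupport
      (HasCompactSupport.intro hc fun x hx => by simp [pd1_of_notMem_tsupport hx])
  have hpt : ∀ x, ‖w x‖ ^ 2 ≤ 2 * pd1 F x + 4 * R ^ 2 * ‖pd1 w x‖ ^ 2 := by
    intro x
    by_cases hx : x ∈ tsupport w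
    · have hwd : DifferentiableAt ℝ w x := hw.differentiable (by norm_num) x
      have hred := hre.differentiable (by norm_num) x
      have himd := him.differentiable (by norm_num) x
      have h1 : pd1 (fun y : ℝ × ℝ => y.1) x = 1 := by
        simp [pd1, show (fun y : ℝ × ℝ => y.1) = Prod.fst from rfl, fderiv_fst]
      have hFx : pd1 F x = x.1 * (2 * ((w x).re * (pd1 w x).re + (w x).im * (pd1 w x).im))
          + ((w x).re * (w x).re + (w x).im * (w x).im) := by
        rw [hF, pd1_mul differentiableAt_fst (by fun_prop), pd1_add (by fun_prop) (by fun_prop),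
          pd1_mul hred hred, pd1_mul himd himd, pd1_re hwd, pd1_im hwd, h1]
        ring
      have hx1 : x.1 ^ 2 ≤ R ^ 2 := by
        have := (norm_fst_le x).trans (hR x hx)
        rw [Real.norm_eq_abs] at this
        exact sq_le_sq' (abs_le.1 this).1 (abs_le.1 this).2
      have hx2 : x.1 ^ 2 * ‖pd1 w x‖ ^ 2 ≤ R ^ 2 * ‖pd1 w x‖ ^ 2 := by gcongr
      rw [hFx]
      simp only [Complex.sq_norm, Complex.normSq_apply] at hx2 ⊢
      nlinarith [sq_nonneg ((w x).re + 2 * x.1 * (pd1 w x).re),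
        sq_nonneg ((w x).im + 2 * x.1 * (pd1 w x).im)]
    · have h1 : x ∉ tsupport F := fun h' => hx (closure_minimal (fun y hy => by
        by_contra hy'
        exact hy (by simp [hF, image_eq_zero_of_notMem_tsupport hy'])) (isClosed_tsupport w) h')
      simp [image_eq_zero_of_notMem_tsupport hx, pd1_of_notMem_tsupport h1,
        pd1_of_notMem_tsupport hx]
  calc ∫ x, ‖w x‖ ^ 2 ≤ ∫ x, (2 * pd1 F x + 4 * R ^ 2 * ‖pd1 w x‖ ^ 2) :=
        integral_mono hwi ((hFi.const_mul _).add (hw1i.const_mul _)) hpt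
    _ = 4 * R ^ 2 * ∫ x, ‖pd1 w x‖ ^ 2 := by
        rw [integral_add (hFi.const_mul _) (hw1i.const_mul _), integral_const_mul,
          integral_const_mul, hF_int]
        ring

section Rayleigh

variable {Ω : Set (ℝ × ℝ)} {ψ B : ℝ × ℝ → ℝ}

lemma pauliDirac_exp_mul {s h : ℝ} (hs : s ^ 2 = 1) (hh : h ≠ 0) {w : ℝ × ℝ → ℂ} {x : ℝ × ℝ}
    (hψ : DifferentiableAt ℝ ψ x) (hw : DifferentiableAt ℝ w x) :
    pauliDirac s h ψ (fun y => (Real.exp (-(s * ψ y / h)) : ℂ) * w y) x =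
      h * Real.exp (-(s * ψ x / h)) * (pd1 w x + s * Complex.I * pd2 w x) := by
  have hE : HasFDerivAt (fun y => ((Real.exp (-(s * ψ y / h)) : ℝ) : ℂ))
      (Complex.ofRealCLM.comp (Real.exp (-(s * ψ x / h)) • (-((s / h) • fderiv ℝ ψ x)))) x := by
    refine Complex.ofRealCLM.hasFDerivAt.comp x (HasFDerivAt.exp ?_)
    have := (hψ.hasFDerivAt.const_mul (s / h)).neg
    refine this.congr_of_eventuallyEq (Eventually.of_forall fun y => ?_)
    simp
    ring
  have hp := (hE.mul hw.hasFDerivAt).fderiv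
  have hs' : (s : ℂ) ^ 2 = 1 := by exact_mod_cast hs
  have hh' : (h : ℂ) ≠ 0 := by exact_mod_cast hh
  have e1 : pd1 (fun y => (Real.exp (-(s * ψ y / h)) : ℂ) * w y) x =
      Real.exp (-(s * ψ x / h)) * (pd1 w x - s / h * pd1 ψ x * w x) := by
    refine (congrArg (fun L => L (1, 0)) hp).trans ?_
    simp [pd1]
    ring
  have e2 : pd2 (fun y => (Real.exp (-(s * ψ y / h)) : ℂ) * w y) x =
      Real.exp (-(s * ψ x / h)) * (pd2 w x - s / h * pd2 ψ x * w x) := by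
    refine (congrArg (fun L => L (0, 1)) hp).trans ?_
    simp [pd2]
    ring
  unfold pauliDirac
  rw [e1, e2]
  simp only [perpGrad]
  push_cast
  field_simp
  ring_nf
  simp only [hs', Complex.I_sq]
  ring

lemma integral_add_sq_pd (w : ℝ × ℝ → ℂ) (hw : ContDiff ℝ 2 w) (hc : HasCompactSupport w) {s : ℝ}
    (hs : s ^ 2 = 1) :
    ∫ x, ‖pd1 w x + s * Complex.I * pd2 w x‖ ^ 2 = ∫ x, (‖pd1 w x‖ ^ 2 + ‖pd2 w x‖ ^ 2) := by
  have := integral_sq_norm_pauliDirac (ψ := fun _ => 0) isOpen_univ contDiffOn_const hw hc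
    (subset_univ _) (h := 1) hs
  have h1 : pd1 (fun _ : ℝ × ℝ => (0 : ℝ)) = fun _ => 0 := by ext; simp [pd1]
  have h2 : pd2 (fun _ : ℝ × ℝ => (0 : ℝ)) = fun _ => 0 := by ext; simp [pd2]
  simpa [pauliDirac, perpGrad, lap, h1, h2] using this

lemma pauliRayleigh_eq (hΩ : IsOpen Ω) (hψ : ContDiffOn ℝ 2 ψ Ω) (hB : ∀ x ∈ Ω, lap ψ x = B x)
    {σ h : ℝ} (hσ : σ ^ 2 = 1) {u : ℝ × ℝ → ℂ} (hu : IsTestFun Ω u) :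
    pauliRayleigh σ h (perpGrad ψ) B Ω u =
      (∫ x, ‖pauliDirac (-σ) h ψ u x‖ ^ 2) / ∫ x, ‖u x‖ ^ 2 := by
  obtain ⟨hu1, hu2, hu3, -⟩ := hu
  have h0 : ∀ x ∉ Ω, x ∉ tsupport u := fun x hx hx' => hx (hu3 hx')
  rw [integral_sq_norm_pauliDirac hΩ hψ (contDiff_infty.1 hu1 2) hu2 hu3
    (by rw [neg_sq, hσ])]
  unfold pauliRayleigh
  have e : ∫ x in Ω, B x * ‖u x‖ ^ 2 = ∫ x in Ω, lap ψ x * ‖u x‖ ^ 2 :=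
    setIntegral_congr_fun hΩ.measurableSet (fun x hx => by simp only [hB x hx])
  rw [e, setIntegral_eq_integral_of_forall_compl_eq_zero,
    setIntegral_eq_integral_of_forall_compl_eq_zero,
    setIntegral_eq_integral_of_forall_compl_eq_zero]
  · ring
  · intro x hx
    simp [image_eq_zero_of_notMem_tsupport (h0 x hx)]
  · intro x hx
    simp [image_eq_zero_of_notMem_tsupport (h0 x hx)]
  · intro x hx
    simp [image_eq_zero_of_notMem_tsupport (h0 x hx), pd1_of_notMem_tsupport (h0 x hx),
      pd2_of_notMem_tsupport (h0 x hx)]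

lemma integral_sq_norm_pos {u : ℝ × ℝ → ℂ} (hu : Continuous u) (hc : HasCompactSupport u)
    (h0 : u ≠ 0) : 0 < ∫ x, ‖u x‖ ^ 2 := by
  have hi : Integrable (fun x => ‖u x‖ ^ 2) :=
    (hu.norm.pow 2).integrable_of_hasCompactSupport
      (HasCompactSupport.intro hc fun x hx => by simp [image_eq_zero_of_notMem_tsupport hx])
  obtain ⟨x, hx⟩ := Function.ne_iff.1 h0
  exact integral_pos_of_integrable_nonneg_nonzero (x := x) (hu.norm.pow 2) hi
    (fun x => by positivity) (by simpa using hx)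

lemma le_pauliRayleigh (hΩ : IsOpen Ω) (hψ : ContDiffOn ℝ 2 ψ Ω) (hB : ∀ x ∈ Ω, lap ψ x = B x)
    {σ h M R : ℝ} (hσ : σ ^ 2 = 1) (hh : 0 < h) (hM : ∀ x ∈ Ω, |ψ x| ≤ M)
    (hR0 : 0 < R) (hR : ∀ x ∈ Ω, ‖x‖ ≤ R) {u : ℝ × ℝ → ℂ} (hu : IsTestFun Ω u) :
    h ^ 2 / (4 * R ^ 2) * Real.exp (-(4 * M / h)) ≤ pauliRayleigh σ h (perpGrad ψ) B Ω u := by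
  rw [pauliRayleigh_eq hΩ hψ hB hσ hu]
  obtain ⟨hu1, hu2, hu3, hu4⟩ := hu
  have hu0 : ∀ x ∉ tsupport u, u x = 0 := fun x hx => image_eq_zero_of_notMem_tsupport hx
  set s : ℝ := -σ with hsdef
  have hs : s ^ 2 = 1 := by rw [hsdef, neg_sq, hσ]
  have hsabs : |s| = 1 := by
    rcases sq_eq_one_iff.1 hs with h | h <;> simp [h]
  rw [le_div_iff₀ (integral_sq_norm_pos hu1.continuous hu2 hu4)]
  have hu2' : ContDiff ℝ 2 u := contDiff_infty.1 hu1 2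
  set w : ℝ × ℝ → ℂ := fun y => (Real.exp (s * ψ y / h) : ℂ) * u y with hw
  have hw0 : ∀ x ∉ tsupport u, w x = 0 := fun x hx => by simp [hw, hu0 x hx]
  have hwc : ContDiff ℝ 2 w := by
    refine contDiff_of_eq_zero_off hΩ (isClosed_tsupport u) hu3 (ContDiffOn.mul ?_
      hu2'.contDiffOn) hw0
    exact Complex.ofRealCLM.contDiff.comp_contDiffOn
      ((contDiffOn_const.mul hψ).div_const h).exp
  have hws : HasCompactSupport w := HasCompactSupport.intro hu2 hw0
  have hwt : tsupport w ⊆ tsupport u := closure_minimal (fun y hy => by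
    by_contra hy'
    exact hy (hw0 y hy')) (isClosed_tsupport u)
  have huw : u = fun y => (Real.exp (-(s * ψ y / h)) : ℂ) * w y := by
    ext y
    simp only [hw]
    rw [← mul_assoc, ← Complex.ofReal_mul, ← Real.exp_add]
    simp
  have hexp : ∀ x ∈ Ω, ∀ t : ℝ, |t| = 1 → Real.exp (-(M / h)) ≤ Real.exp (t * ψ x / h) := by
    intro x hx t ht
    rw [Real.exp_le_exp, ← neg_div]
    gcongr
    have : |t * ψ x| ≤ M := by rw [abs_mul, ht, one_mul]; exact hM x hx
    exact (abs_le.1 this).1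
  have hdirac : ∀ x ∈ Ω, pauliDirac s h ψ u x =
      h * Real.exp (-(s * ψ x / h)) * (pd1 w x + s * Complex.I * pd2 w x) := by
    intro x hx
    conv_lhs => rw [huw]
    exact pauliDirac_exp_mul hs hh.ne' ((hψ.contDiffAt (hΩ.mem_nhds hx)).differentiableAt
      (by norm_num)) (hwc.differentiable (by norm_num) x)
  have hsq : Real.exp (-(M / h)) ^ 2 = Real.exp (-(2 * M / h)) := by
    rw [← Real.exp_nat_mul]; congr 1; push_cast; ring
  have hw1 : Continuous (pd1 w) :=
    (hwc.continuous_fderiv (by norm_num)).clm_apply continuous_const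
  have hw2 : Continuous (pd2 w) :=
    (hwc.continuous_fderiv (by norm_num)).clm_apply continuous_const
  have hw1i : Integrable (fun x => ‖pd1 w x‖ ^ 2) :=
    (hw1.norm.pow 2).integrable_of_hasCompactSupport
      (HasCompactSupport.intro hws fun x hx => by simp [pd1_of_notMem_tsupport hx])
  have hw2i : Integrable (fun x => ‖pd2 w x‖ ^ 2) :=
    (hw2.norm.pow 2).integrable_of_hasCompactSupport
      (HasCompactSupport.intro hws fun x hx => by simp [pd2_of_notMem_tsupport hx])
  have hw12i : Integrable (fun x => ‖pd1 w x + s * Complex.I * pd2 w x‖ ^ 2) :=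
    ((hw1.add (continuous_const.mul hw2)).norm.pow 2).integrable_of_hasCompactSupport
      (HasCompactSupport.intro hws fun x hx => by
        simp [pd1_of_notMem_tsupport hx, pd2_of_notMem_tsupport hx])
  have hui : Integrable (fun x => ‖u x‖ ^ 2) :=
    (hu1.continuous.norm.pow 2).integrable_of_hasCompactSupport
      (HasCompactSupport.intro hu2 fun x hx => by simp [hu0 x hx])
  have hwi : Integrable (fun x => ‖w x‖ ^ 2) :=
    (hwc.continuous.norm.pow 2).integrable_of_hasCompactSupport
      (HasCompactSupport.intro hu2 fun x hx => by simp [hw0 x hx])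
  have hdi : Integrable (fun x => ‖pauliDirac s h ψ u x‖ ^ 2) :=
    integrable_of_eq_zero_off hΩ hu2 hu3
      ((continuousOn_pauliDirac hΩ (hψ.of_le (by norm_num))
        (hu2'.of_le (by norm_num)).contDiffOn s h).norm.pow 2)
      fun x hx => by simp [pauliDirac_of_notMem_tsupport hx]
  have i1 : Real.exp (-(2 * M / h)) * ∫ x, ‖u x‖ ^ 2 ≤ ∫ x, ‖w x‖ ^ 2 := by
    rw [← integral_const_mul]
    refine integral_mono (hui.const_mul _) hwi fun x => ?_
    by_cases hx : x ∈ tsupport u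
    · simp only [hw, norm_mul, mul_pow, Complex.norm_real, Real.norm_eq_abs, Real.abs_exp]
      rw [← hsq]
      exact mul_le_mul_of_nonneg_right (pow_le_pow_left₀ (by positivity)
        (hexp x (hu3 hx) s hsabs) 2) (by positivity)
    · simp [hu0 x hx]
  have i2 : h ^ 2 * Real.exp (-(2 * M / h)) * ∫ x, ‖pd1 w x + s * Complex.I * pd2 w x‖ ^ 2 ≤
      ∫ x, ‖pauliDirac s h ψ u x‖ ^ 2 := by
    rw [← integral_const_mul]
    refine integral_mono (hw12i.const_mul _) hdi fun x => ?_
    by_cases hx : x ∈ tsupport u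
    · simp only [hdirac x (hu3 hx), norm_mul, mul_pow, Complex.norm_real, Real.norm_eq_abs,
        Real.abs_exp, sq_abs]
      rw [← hsq]
      have := hexp x (hu3 hx) (-s) (by rw [abs_neg, hsabs])
      rw [neg_mul, neg_div] at this
      exact mul_le_mul_of_nonneg_right (mul_le_mul_of_nonneg_left
        (pow_le_pow_left₀ (by positivity) this 2) (by positivity)) (by positivity)
    · simp [pauliDirac_of_notMem_tsupport hx, pd1_of_notMem_tsupport (fun h => hx (hwt h)),
        pd2_of_notMem_tsupport (fun h => hx (hwt h))]
  rw [integral_add_sq_pd w hwc hws hs] at i2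
  have i3 : ∫ x, ‖pd1 w x‖ ^ 2 ≤ ∫ x, (‖pd1 w x‖ ^ 2 + ‖pd2 w x‖ ^ 2) :=
    integral_mono hw1i (hw1i.add hw2i) fun x => by simp
  have i4 := poincare_pd1 (hwc.of_le (by norm_num)) hws fun x hx => hR x (hu3 (hwt hx))
  have hsq2 : Real.exp (-(4 * M / h)) = Real.exp (-(2 * M / h)) * Real.exp (-(2 * M / h)) := by
    rw [← Real.exp_add]; congr 1; ring
  calc h ^ 2 / (4 * R ^ 2) * Real.exp (-(4 * M / h)) * ∫ x, ‖u x‖ ^ 2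
      = h ^ 2 / (4 * R ^ 2) * Real.exp (-(2 * M / h)) *
          (Real.exp (-(2 * M / h)) * ∫ x, ‖u x‖ ^ 2) := by rw [hsq2]; ring
    _ ≤ h ^ 2 / (4 * R ^ 2) * Real.exp (-(2 * M / h)) * (4 * R ^ 2 * ∫ x, ‖pd1 w x‖ ^ 2) := by
        exact mul_le_mul_of_nonneg_left (i1.trans i4) (by positivity)
    _ = h ^ 2 * Real.exp (-(2 * M / h)) * ∫ x, ‖pd1 w x‖ ^ 2 := by field_simp
    _ ≤ _ := le_trans (by gcongr) i2

end Rayleigh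

/-- Mollification: a compactly supported `C¹` function is uniformly approximated in `C¹` by smooth
functions supported in a small neighbourhood of its support. -/
lemma exists_smooth_C1_approx {G E : Type*} [NormedAddCommGroup G] [NormedSpace ℝ G]
    [FiniteDimensional ℝ G] [NormedAddCommGroup E] [NormedSpace ℝ E] [CompleteSpace E]
    {u : G → E} (hu : ContDiff ℝ 1 u) (hc : HasCompactSupport u) {η δ : ℝ} (hη : 0 < η)
    (hδ : 0 < δ) :
    ∃ w : G → E, ContDiff ℝ (⊤ : ℕ∞) w ∧ tsupport w ⊆ Metric.cthickening δ (tsupport u) ∧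
      ∀ x, ‖w x - u x‖ ≤ η ∧ ‖fderiv ℝ w x - fderiv ℝ u x‖ ≤ η := by
  borelize G
  have hu' : Continuous (fderiv ℝ u) := hu.continuous_fderiv (by norm_num)
  obtain ⟨ε₁, hε₁, h₁⟩ := Metric.uniformContinuous_iff.1
    (hc.uniformContinuous_of_continuous hu.continuous) η hη
  obtain ⟨ε₂, hε₂, h₂⟩ := Metric.uniformContinuous_iff.1
    ((hc.fderiv ℝ).uniformContinuous_of_continuous hu') η hη
  set ε := min δ (min ε₁ ε₂) with hεdef
  have hε : 0 < ε := lt_min hδ (lt_min hε₁ hε₂)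
  let φ : ContDiffBump (0 : G) := ⟨ε / 2, ε, by positivity, by linarith⟩
  let μ : Measure G := Measure.addHaar
  have hloc : LocallyIntegrable (φ.normed μ) μ := φ.continuous_normed.locallyIntegrable
  refine ⟨convolution (φ.normed μ) u (ContinuousLinearMap.lsmul ℝ ℝ) μ,
    φ.hasCompactSupport_normed.contDiff_convolution_left _ φ.contDiff_normed
      hu.continuous.locallyIntegrable, ?_, fun x => ⟨?_, ?_⟩⟩
  · refine closure_minimal ((support_convolution_subset _).trans ?_) Metric.isClosed_cthickening
    rw [φ.support_normed_eq]
    rintro _ ⟨a, ha, b, hb, rfl⟩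
    refine Metric.mem_cthickening_of_dist_le _ b δ _ (subset_tsupport u hb) ?_
    have ha' : ‖a‖ < ε := by simpa using ha
    simpa using ha'.le.trans (min_le_left _ _)
  · rw [← dist_eq_norm]
    refine φ.dist_normed_convolution_le hu.continuous.aestronglyMeasurable fun y hy => (h₁ ?_).le
    exact lt_of_lt_of_le hy ((min_le_right _ _).trans (min_le_left _ _))
  · rw [(hc.hasFDerivAt_convolution_right (ContinuousLinearMap.lsmul ℝ ℝ) hloc hu x).fderiv]
    have e : convolution (φ.normed μ) (fderiv ℝ u)
          ((ContinuousLinearMap.lsmul ℝ ℝ : ℝ →L[ℝ] E →L[ℝ] E).precompR G) μ x =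
        convolution (φ.normed μ) (fderiv ℝ u) (ContinuousLinearMap.lsmul ℝ ℝ) μ x := by
      unfold convolution
      congr 1
    rw [e, ← dist_eq_norm]
    refine φ.dist_normed_convolution_le hu'.aestronglyMeasurable fun y hy => (h₂ ?_).le
    exact lt_of_lt_of_le hy ((min_le_right _ _).trans (min_le_right _ _))

section UpperBound

variable {Ω : Set (ℝ × ℝ)} {ψ B : ℝ × ℝ → ℝ}

lemma norm_pauliDirac_le (h : ℝ) (u : ℝ × ℝ → ℂ) (x : ℝ × ℝ) :
    ‖pauliDirac 1 h ψ u x‖ ≤ 2 * |h| * ‖fderiv ℝ u x‖ + 2 * ‖fderiv ℝ ψ x‖ * ‖u x‖ := by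
  have h1 := norm_pd1_le u x
  have h2 := norm_pd2_le u x
  have h3 := norm_pd1_le ψ x
  have h4 := norm_pd2_le ψ x
  unfold pauliDirac perpGrad
  calc _ ≤ (|h| * ‖pd1 u x‖ + ‖pd2 ψ x‖ * ‖u x‖) + (|h| * ‖pd2 u x‖ + ‖pd1 ψ x‖ * ‖u x‖) := by
        refine (norm_add_le _ _).trans (add_le_add ?_ ?_)
        · exact (norm_sub_le _ _).trans (by simp)
        · rw [norm_mul]
          simpa using norm_sub_le ((h : ℂ) * pd2 u x) (Complex.I * ((pd1 ψ x : ℝ) : ℂ) * u x)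
    _ ≤ (|h| * ‖fderiv ℝ u x‖ + ‖fderiv ℝ ψ x‖ * ‖u x‖) +
        (|h| * ‖fderiv ℝ u x‖ + ‖fderiv ℝ ψ x‖ * ‖u x‖) := by gcongr
    _ = _ := by ring

lemma pauliDirac_sub {h : ℝ} {u w : ℝ × ℝ → ℂ} {x : ℝ × ℝ} (hu : DifferentiableAt ℝ u x)
    (hw : DifferentiableAt ℝ w x) :
    pauliDirac 1 h ψ (w - u) x = pauliDirac 1 h ψ w x - pauliDirac 1 h ψ u x := by
  simp only [pauliDirac, pd1, pd2, fderiv_sub hw hu, sub_apply, Pi.sub_apply]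
  ring

/-- The ground state energy is bounded by the Rayleigh quotients of compactly supported functions
that are only of class `C¹`. -/
lemma lambdaMinusD_le (hΩ : IsOpen Ω) (hψ : ContDiffOn ℝ 2 ψ Ω) (hB : ∀ x ∈ Ω, lap ψ x = B x)
    {h : ℝ} {u : ℝ × ℝ → ℂ} (hu : ContDiff ℝ 1 u) (hc : HasCompactSupport u)
    (hs : tsupport u ⊆ Ω) (hu0 : u ≠ 0) :
    lambdaMinusD h (perpGrad ψ) B Ω ≤ (∫ x, ‖pauliDirac 1 h ψ u x‖ ^ 2) / ∫ x, ‖u x‖ ^ 2 := by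
  obtain ⟨δ, hδ, hδΩ⟩ := hc.exists_cthickening_subset_open hΩ hs
  set K := Metric.cthickening δ (tsupport u) with hK
  have hKc : IsCompact K := hc.cthickening
  have huK : tsupport u ⊆ K := Metric.self_subset_cthickening _
  choose w hw hwK hwu using fun n : ℕ =>
    exists_smooth_C1_approx hu hc (Nat.one_div_pos_of_nat (α := ℝ) (n := n)) hδ
  have hη1 : ∀ n : ℕ, 1 / ((n : ℝ) + 1) ≤ 1 := fun n => by
    rw [div_le_one (by positivity)]; linarith [n.cast_nonneg (α := ℝ)]
  have hη0 : Tendsto (fun n : ℕ => 1 / ((n : ℝ) + 1)) atTop (𝓝 0) :=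
    tendsto_one_div_add_atTop_nhds_zero_nat
  have hwd : ∀ n, Differentiable ℝ (w n) := fun n => (hw n).differentiable (by simp)
  have hud : Differentiable ℝ u := hu.differentiable (by norm_num)
  have hu' : Continuous (fderiv ℝ u) := hu.continuous_fderiv (by norm_num)
  have hψ' : ContinuousOn (fderiv ℝ ψ) Ω :=
    (hψ.fderiv_of_isOpen (m := 1) hΩ (by norm_num)).continuousOn
  have hwc : ∀ n, HasCompactSupport (w n) := fun n =>
    hKc.of_isClosed_subset (isClosed_tsupport _) (hwK n)
  have hlim : ∀ x, Tendsto (fun n => w n x) atTop (𝓝 (u x)) := fun x => by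
    rw [tendsto_iff_norm_sub_tendsto_zero]
    exact squeeze_zero (fun _ => norm_nonneg _) (fun n => (hwu n x).1) hη0
  have hlim' : ∀ x, Tendsto (fun n => pauliDirac 1 h ψ (w n) x) atTop
      (𝓝 (pauliDirac 1 h ψ u x)) := fun x => by
    rw [tendsto_iff_norm_sub_tendsto_zero]
    refine squeeze_zero (g := fun n : ℕ => (2 * |h| + 2 * ‖fderiv ℝ ψ x‖) * (1 / ((n : ℝ) + 1)))
      (fun _ => norm_nonneg _) (fun n => ?_) (by simpa using hη0.const_mul _)
    rw [← pauliDirac_sub (hud x) (hwd n x)]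
    refine (norm_pauliDirac_le _ _ _).trans ?_
    rw [fderiv_sub (hwd n x) (hud x), add_mul]
    gcongr
    · exact (hwu n x).2
    · exact (hwu n x).1
  have hmeas : ∀ n, AEStronglyMeasurable (fun x => ‖pauliDirac 1 h ψ (w n) x‖ ^ 2) volume :=
    fun n => (integrable_of_eq_zero_off hΩ (hwc n) ((hwK n).trans hδΩ)
      ((continuousOn_pauliDirac hΩ (hψ.of_le (by norm_num))
        ((contDiff_infty.1 (hw n) 1).contDiffOn) 1 h).norm.pow 2)
      fun x hx => by simp [pauliDirac_of_notMem_tsupport hx]).aestronglyMeasurable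
  have hnum : Tendsto (fun n => ∫ x, ‖pauliDirac 1 h ψ (w n) x‖ ^ 2) atTop
      (𝓝 (∫ x, ‖pauliDirac 1 h ψ u x‖ ^ 2)) := by
    refine tendsto_integral_of_dominated_convergence
      (K.indicator fun x => (2 * |h| * (‖fderiv ℝ u x‖ + 1) +
        2 * ‖fderiv ℝ ψ x‖ * (‖u x‖ + 1)) ^ 2) hmeas ?_
      (fun n => Eventually.of_forall fun x => ?_)
      (Eventually.of_forall fun x => ((hlim' x).norm.pow 2))
    · rw [integrable_indicator_iff hKc.isClosed.measurableSet]
      refine ContinuousOn.integrableOn_compact hKc ?_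
      have h1 := hψ'.mono hδΩ
      have h2 := hu.continuous
      fun_prop
    · by_cases hx : x ∈ K
      · rw [indicator_of_mem hx, norm_pow, norm_norm]
        refine pow_le_pow_left₀ (norm_nonneg _) ((norm_pauliDirac_le _ _ _).trans ?_) 2
        have h1 := norm_le_norm_add_norm_sub' (w n x) (u x)
        have h2 := norm_le_norm_add_norm_sub' (fderiv ℝ (w n) x) (fderiv ℝ u x)
        have h3 := (hwu n x).1
        have h4 := (hwu n x).2
        gcongr
        · linarith [hη1 n]
        · linarith [hη1 n]
      · rw [indicator_of_notMem hx, pauliDirac_of_notMem_tsupport fun h' => hx (hwK n h')]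
        simp
  have hden : Tendsto (fun n => ∫ x, ‖w n x‖ ^ 2) atTop (𝓝 (∫ x, ‖u x‖ ^ 2)) := by
    refine tendsto_integral_of_dominated_convergence
      (K.indicator fun x => (‖u x‖ + 1) ^ 2)
      (fun n => ((hw n).continuous.norm.pow 2).aestronglyMeasurable) ?_
      (fun n => Eventually.of_forall fun x => ?_)
      (Eventually.of_forall fun x => ((hlim x).norm.pow 2))
    · rw [integrable_indicator_iff hKc.isClosed.measurableSet]
      refine ContinuousOn.integrableOn_compact hKc ?_
      have h2 := hu.continuous
      fun_prop
    · by_cases hx : x ∈ K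
      · rw [indicator_of_mem hx, norm_pow, norm_norm]
        have h1 := norm_le_norm_add_norm_sub' (w n x) (u x)
        have h3 := (hwu n x).1
        gcongr
        linarith [hη1 n]
      · rw [indicator_of_notMem hx, image_eq_zero_of_notMem_tsupport fun h' => hx (hwK n h')]
        simp
  have hpos := integral_sq_norm_pos hu.continuous hc hu0
  refine ge_of_tendsto (hnum.div hden hpos.ne') ?_
  filter_upwards [hden.eventually_const_lt hpos] with n hn
  have hwn : IsTestFun Ω (w n) := by
    refine ⟨hw n, hwc n, (hwK n).trans hδΩ, fun h0 => ?_⟩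
    simp [h0] at hn
  have hr : ∀ v, IsTestFun Ω v → pauliRayleigh (-1) h (perpGrad ψ) B Ω v =
      (∫ x, ‖pauliDirac 1 h ψ v x‖ ^ 2) / ∫ x, ‖v x‖ ^ 2 := fun v hv => by
    simpa using pauliRayleigh_eq hΩ hψ hB (σ := -1) (h := h) (by norm_num) hv
  refine csInf_le ⟨0, ?_⟩ ⟨w n, hwn, hr _ hwn⟩
  rintro _ ⟨v, hv, rfl⟩
  rw [hr v hv]
  positivity

end UpperBound

lemma exists_smooth_cutoff {K U : Set (ℝ × ℝ)} (hK : IsCompact K) (hU : IsOpen U) (hKU : K ⊆ U) :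
    ∃ v : ℝ × ℝ → ℝ, ContDiff ℝ (⊤ : ℕ∞) v ∧ HasCompactSupport v ∧ tsupport v ⊆ U ∧
      ∀ x ∈ K, v =ᶠ[𝓝 x] fun _ => 1 := by
  obtain ⟨L, hL, hKL, hLU⟩ := exists_compact_between hK hU hKU
  obtain ⟨f, hf1, hf0, -⟩ := exists_contMDiffMap_one_nhds_of_subset_interior
    (n := (⊤ : ℕ∞)) (modelWithCornersSelf ℝ (ℝ × ℝ)) hK.isClosed hKL
  refine ⟨f, f.contMDiff.contDiff, HasCompactSupport.intro hL hf0, ?_,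
    fun x hx => mem_nhdsSet_iff_forall.1 hf1 x hx⟩
  refine (closure_minimal (fun x hx => ?_) hL.isClosed).trans hLU
  by_contra hx'
  exact hx (hf0 x hx')

section Estimates

variable {Ω : Set (ℝ × ℝ)} {ψ B : ℝ × ℝ → ℝ}

/-- If `v` is a cutoff function that is locally constant where `ψ < a` and equal to `1` near a
point where `ψ < b`, then the quasimode `exp (-ψ / h) * v` has exponentially small energy. -/
lemma exists_lambdaMinusD_le_exp (hΩ : IsOpen Ω) (hψ : ContDiffOn ℝ 2 ψ Ω)
    (hB : ∀ x ∈ Ω, lap ψ x = B x) {v : ℝ × ℝ → ℝ} (hv : ContDiff ℝ (⊤ : ℕ∞) v)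
    (hc : HasCompactSupport v) (hs : tsupport v ⊆ Ω) {a b : ℝ}
    (ha : ∀ x ∈ Ω, fderiv ℝ v x ≠ 0 → a ≤ ψ x) {p : ℝ × ℝ} (hp : p ∈ Ω)
    (hv1 : v =ᶠ[𝓝 p] fun _ => 1) (hb : ψ p < b) :
    ∃ C > 0, ∀ h : ℝ, 0 < h → h < 1 →
      lambdaMinusD h (perpGrad ψ) B Ω ≤ C * Real.exp (-(2 * (a - b) / h)) := by
  set V : ℝ × ℝ → ℂ := fun x => (v x : ℂ) with hVdef
  have hV : ContDiff ℝ (⊤ : ℕ∞) V := Complex.ofRealCLM.contDiff.comp hv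
  have hV1 : ContDiff ℝ 1 V := contDiff_infty.1 hV 1
  have hV0 : ∀ x ∉ tsupport v, V x = 0 := fun x hx => by
    simp [hVdef, image_eq_zero_of_notMem_tsupport hx]
  have hVc : HasCompactSupport V := HasCompactSupport.intro hc hV0
  have hVt : tsupport V ⊆ tsupport v := closure_minimal (fun y hy => by
    by_contra hy'
    exact hy (hV0 y hy')) (isClosed_tsupport v)
  have hVd : ∀ x, fderiv ℝ v x = 0 → fderiv ℝ V x = 0 := fun x hx => by
    have := (Complex.ofRealCLM.hasFDerivAt.comp x
      (hv.differentiable (by simp) x).hasFDerivAt).fderiv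
    rw [hx, ContinuousLinearMap.comp_zero] at this
    exact this
  set g : ℝ × ℝ → ℂ := fun x => pd1 V x + ((1 : ℝ) : ℂ) * Complex.I * pd2 V x with hg
  have hgc : Continuous g := by
    have h1 : Continuous (pd1 V) :=
      (hV1.continuous_fderiv (by norm_num)).clm_apply continuous_const
    have h2 : Continuous (pd2 V) :=
      (hV1.continuous_fderiv (by norm_num)).clm_apply continuous_const
    fun_prop
  have hg0 : ∀ x ∉ tsupport v, g x = 0 := fun x hx => by
    simp [hg, pd1_of_notMem_tsupport fun h' => hx (hVt h'),
      pd2_of_notMem_tsupport fun h' => hx (hVt h')]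
  have hgi : Integrable (fun x => ‖g x‖ ^ 2) :=
    (hgc.norm.pow 2).integrable_of_hasCompactSupport
      (HasCompactSupport.intro hc fun x hx => by simp [hg0 x hx])
  have hnear : ∀ᶠ x in 𝓝 p, v x = 1 ∧ ψ x < b :=
    hv1.and ((hψ.continuousOn.continuousAt (hΩ.mem_nhds hp)).eventually_lt continuousAt_const hb)
  obtain ⟨r, hr, hball⟩ := Metric.eventually_nhds_iff_ball.1 hnear
  set c : ℝ := volume.real (Metric.ball p r) with hcdef
  have hcpos : 0 < c :=
    ENNReal.toReal_pos (Metric.measure_ball_pos volume p hr).ne' measure_ball_lt_top.ne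
  refine ⟨((∫ x, ‖g x‖ ^ 2) + 1) / c, div_pos (add_pos_of_nonneg_of_pos
    (integral_nonneg fun x => by positivity) one_pos) hcpos, fun h h0 h1 => ?_⟩
  set u : ℝ × ℝ → ℂ := fun y => (Real.exp (-(1 * ψ y / h)) : ℂ) * V y with hudef
  have hu0 : ∀ x ∉ tsupport v, u x = 0 := fun x hx => by simp [hudef, hV0 x hx]
  have hu : ContDiff ℝ 1 u := by
    refine contDiff_of_eq_zero_off hΩ (isClosed_tsupport v) hs (ContDiffOn.mul ?_
      hV1.contDiffOn) hu0
    exact Complex.ofRealCLM.contDiff.comp_contDiffOn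
      ((contDiffOn_const.mul (hψ.of_le (by norm_num))).div_const h).neg.exp
  have huc : HasCompactSupport u := HasCompactSupport.intro hc hu0
  have hut : tsupport u ⊆ tsupport v := closure_minimal (fun y hy => by
    by_contra hy'
    exact hy (hu0 y hy')) (isClosed_tsupport v)
  have hune : u ≠ 0 := fun h' => by
    have h2 := congrFun h' p
    simp [hudef, hVdef, (hball p (Metric.mem_ball_self hr)).1] at h2
  have hnum : ∫ x, ‖pauliDirac 1 h ψ u x‖ ^ 2 ≤ Real.exp (-(2 * a / h)) * ∫ x, ‖g x‖ ^ 2 := by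
    have hdi : Integrable (fun x => ‖pauliDirac 1 h ψ u x‖ ^ 2) :=
      integrable_of_eq_zero_off hΩ huc (hut.trans hs)
        ((continuousOn_pauliDirac hΩ (hψ.of_le (by norm_num)) hu.contDiffOn 1 h).norm.pow 2)
        fun x hx => by simp [pauliDirac_of_notMem_tsupport hx]
    rw [← integral_const_mul]
    refine integral_mono hdi (hgi.const_mul _) fun x => ?_
    by_cases hx : x ∈ tsupport v
    · have hxΩ := hs hx
      have e := pauliDirac_exp_mul (s := 1) (h := h) (by norm_num) h0.ne' (w := V)
        ((hψ.contDiffAt (hΩ.mem_nhds hxΩ)).differentiableAt (by norm_num))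
        (hV1.differentiable (by norm_num) x)
      simp only [hudef, e]
      by_cases hd : fderiv ℝ v x = 0
      · simp [hg, pd1, pd2, hVd x hd]
      · have hax := ha x hxΩ hd
        simp only [norm_mul, mul_pow, Complex.norm_real, Real.norm_eq_abs, Real.abs_exp, sq_abs]
        refine mul_le_mul_of_nonneg_right ?_ (by positivity)
        calc h ^ 2 * Real.exp (-(1 * ψ x / h)) ^ 2
            ≤ 1 * Real.exp (-(1 * ψ x / h)) ^ 2 := by
              gcongr
              exact pow_le_one₀ h0.le h1.le
          _ = Real.exp (-(2 * ψ x / h)) := by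
              rw [one_mul, ← Real.exp_nat_mul]; congr 1; push_cast; ring
          _ ≤ Real.exp (-(2 * a / h)) := by gcongr
    · simp [pauliDirac_of_notMem_tsupport fun h' => hx (hut h')]
      positivity
  have hden : Real.exp (-(2 * b / h)) * c ≤ ∫ x, ‖u x‖ ^ 2 := by
    have hui : Integrable (fun x => ‖u x‖ ^ 2) :=
      (hu.continuous.norm.pow 2).integrable_of_hasCompactSupport
        (HasCompactSupport.intro hc fun x hx => by simp [hu0 x hx])
    calc Real.exp (-(2 * b / h)) * c = ∫ x in Metric.ball p r, Real.exp (-(2 * b / h)) := by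
          rw [setIntegral_const, smul_eq_mul, mul_comm]
      _ ≤ ∫ x in Metric.ball p r, ‖u x‖ ^ 2 := by
          refine setIntegral_mono_on (integrableOn_const measure_ball_lt_top.ne)
            hui.integrableOn measurableSet_ball fun x hx => ?_
          obtain ⟨hx1, hx2⟩ := hball x hx
          simp only [hudef, hVdef, hx1, norm_mul, mul_pow, Complex.norm_real, Real.norm_eq_abs,
            Real.abs_exp]
          rw [← Real.exp_nat_mul, abs_one, one_pow, mul_one, Real.exp_le_exp]
          have : 2 * ψ x / h ≤ 2 * b / h := by gcongr
          push_cast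
          linarith [show 2 * -(1 * ψ x / h) = -(2 * ψ x / h) by ring]
      _ ≤ ∫ x, ‖u x‖ ^ 2 := setIntegral_le_integral hui
          (Eventually.of_forall fun x => by positivity)
  calc lambdaMinusD h (perpGrad ψ) B Ω
      ≤ (∫ x, ‖pauliDirac 1 h ψ u x‖ ^ 2) / ∫ x, ‖u x‖ ^ 2 :=
        lambdaMinusD_le hΩ hψ hB hu huc (hut.trans hs) hune
    _ ≤ (Real.exp (-(2 * a / h)) * ((∫ x, ‖g x‖ ^ 2) + 1)) / (Real.exp (-(2 * b / h)) * c) := by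
        refine div_le_div₀ (mul_nonneg (Real.exp_nonneg _) (add_nonneg
          (integral_nonneg fun x => by positivity) zero_le_one)) (hnum.trans ?_)
          (by positivity) hden
        gcongr
        linarith
    _ = ((∫ x, ‖g x‖ ^ 2) + 1) / c * Real.exp (-(2 * (a - b) / h)) := by
        have : Real.exp (-(2 * (a - b) / h)) =
            Real.exp (-(2 * a / h)) / Real.exp (-(2 * b / h)) := by
          rw [← Real.exp_sub]; congr 1; ring
        rw [this]
        field_simp

lemma le_LambdaD (hΩ : IsOpen Ω) (hne : Ω.Nonempty) (hψ : ContDiffOn ℝ 2 ψ Ω)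
    (hB : ∀ x ∈ Ω, lap ψ x = B x) {h M R : ℝ} (hh : 0 < h) (hM : ∀ x ∈ Ω, |ψ x| ≤ M)
    (hR0 : 0 < R) (hR : ∀ x ∈ Ω, ‖x‖ ≤ R) :
    h ^ 2 / (4 * R ^ 2) * Real.exp (-(4 * M / h)) ≤ LambdaD h (perpGrad ψ) B Ω := by
  obtain ⟨p, hp⟩ := hne
  obtain ⟨v, hv, hc, hs, hv1⟩ := exists_smooth_cutoff isCompact_singleton hΩ
    (singleton_subset_iff.2 hp)
  have hv0 : ∀ x ∉ tsupport v, ((v x : ℝ) : ℂ) = 0 := fun x hx => by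
    simp [image_eq_zero_of_notMem_tsupport hx]
  have htest : IsTestFun Ω fun x => (v x : ℂ) := by
    refine ⟨Complex.ofRealCLM.contDiff.comp hv, HasCompactSupport.intro hc hv0,
      (closure_minimal (fun y hy => ?_) (isClosed_tsupport v)).trans hs, fun h0 => ?_⟩
    · by_contra hy'
      exact hy (hv0 y hy')
    · have h2 := congrFun h0 p
      simp [(hv1 p rfl).self_of_nhds] at h2
  refine le_min (le_csInf ⟨_, _, htest, rfl⟩ ?_) (le_csInf ⟨_, _, htest, rfl⟩ ?_)
  · rintro _ ⟨u, hu, rfl⟩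
    exact le_pauliRayleigh hΩ hψ hB (by norm_num) hh hM hR0 hR hu
  · rintro _ ⟨u, hu, rfl⟩
    exact le_pauliRayleigh hΩ hψ hB (by norm_num) hh hM hR0 hR hu

end Estimates

/-- Cutoff functions adapted to a barrier: if a compact set `Γ ⊆ Ω` on which `a < ψ` encloses a
point `p` and `Ω` is simply connected, then there is a cutoff function equal to `1` near `p`
that is locally constant where `ψ < a`. -/
lemma exists_cutoff_of_mem_curveInterior {Ω Γ : Set (ℝ × ℝ)} {ψ : ℝ × ℝ → ℝ} {a : ℝ} {p : ℝ × ℝ}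
    (hΩ : IsOpen Ω) (hsc : SimplyConnectedSpace Ω) (hψ : ContinuousOn ψ Ω) (hΓ : IsClosed Γ)
    (hΓΩ : Γ ⊆ Ω) (hΓa : ∀ x ∈ Γ, a < ψ x) (hp : p ∈ curveInterior Γ) :
    ∃ v : ℝ × ℝ → ℝ, ContDiff ℝ (⊤ : ℕ∞) v ∧ HasCompactSupport v ∧ tsupport v ⊆ Ω ∧
      (∀ x ∈ Ω, fderiv ℝ v x ≠ 0 → a ≤ ψ x) ∧ v =ᶠ[𝓝 p] fun _ => 1 := by
  obtain ⟨hpΓ, hUb⟩ := hp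
  set U := connectedComponentIn Γᶜ p with hUdef
  have hUo : IsOpen U := hΓ.isOpen_compl.connectedComponentIn
  have hpU : p ∈ U := mem_connectedComponentIn hpΓ
  have hfr : frontier U ⊆ Γ := frontier_connectedComponentIn_subset hΓ p
  have hUΩ : U ⊆ Ω := subset_of_frontier_subset hΩ hsc hUb (hfr.trans hΓΩ)
  set W := Ω ∩ ψ ⁻¹' Ioi a with hW
  have hWo : IsOpen W := hψ.isOpen_inter_preimage hΩ isOpen_Ioi
  have hKc : IsCompact (closure U \ W) := hUb.isCompact_closure.diff hWo
  have hKU : closure U \ W ⊆ U := fun x hx => by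
    by_contra hxU
    have hxΓ : x ∈ Γ := hfr (by rw [hUo.frontier_eq]; exact ⟨hx.1, hxU⟩)
    exact hx.2 ⟨hΓΩ hxΓ, hΓa x hxΓ⟩
  obtain ⟨v, hv, hc, hs, hv1⟩ := exists_smooth_cutoff (hKc.insert p) hUo
    (insert_subset hpU hKU)
  refine ⟨v, hv, hc, hs.trans hUΩ, fun x hx hd => ?_, hv1 p (mem_insert _ _)⟩
  by_contra hax
  have hxU : x ∈ U := by
    by_contra hxU
    exact hd (fderiv_of_notMem_tsupport ℝ fun h' => hxU (hs h'))
  have hxK : x ∈ closure U \ W := ⟨subset_closure hxU, fun hxW => hax (le_of_lt hxW.2)⟩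
  exact hd (by rw [(hv1 x (mem_insert_of_mem _ hxK)).fderiv_eq]; simp)

/-- Theorem 7.1 / `thm-closedsp`: if `x_sp` is a critical point of
`ψ₀` with `ψ_min < 0 < ψ_sp := ψ₀(x_sp)` and `ψ₀⁻¹(ψ_sp)` contains a `C^{2,α}` simple
closed curve enclosing a nonempty part of `ψ₀⁻¹(ψ_min)`, then
`limsup_{h→0⁺} h·log Λ^D(h,B,Ω) ≤ −2(ψ_sp − ψ_min)`. -/
theorem pauli_full_limsup_saddle (Ω : Set (ℝ × ℝ)) (B ψ₀ : ℝ × ℝ → ℝ) (xsp : ℝ × ℝ)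
    (hR : AssumptionR Ω B) (hsc : SimplyConnectedSpace Ω)
    (hψ : IsScalarPotential Ω B ψ₀)
    (hxsp : xsp ∈ Ω) (hcrit : fderiv ℝ ψ₀ xsp = 0)
    (hmin : sInf (ψ₀ '' Ω) < 0) (hsp : 0 < ψ₀ xsp)
    (hcurve : ∃ α > 0, ∃ Γ : Set (ℝ × ℝ), IsC2ClosedCurve α Γ ∧
      Γ ⊆ closure Ω ∩ ψ₀ ⁻¹' {ψ₀ xsp} ∧
      (curveInterior Γ ∩ closure Ω ∩ ψ₀ ⁻¹' {sInf (ψ₀ '' Ω)}).Nonempty) :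
    limsup (fun h : ℝ => h * Real.log (LambdaD h (perpGrad ψ₀) B Ω)) (𝓝[>] 0)
      ≤ -(2 * (ψ₀ xsp - sInf (ψ₀ '' Ω))) := by
  obtain ⟨hΩ, hbdd, -, -⟩ := hR
  obtain ⟨α, -, Γ, ⟨γ, -, hγ, -, rfl⟩, hΓ, p, ⟨hpint, hpcl⟩, hpmin⟩ := hcurve
  set Γ := γ '' Icc 0 1 with hΓdef
  set m := sInf (ψ₀ '' Ω) with hm
  have hmem : ∀ x ∈ closure Ω, ψ₀ x ≠ 0 → x ∈ Ω := fun x hx h0 => by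
    by_contra hxΩ
    exact h0 (hψ.bdry x (by rw [hΩ.frontier_eq]; exact ⟨hx, hxΩ⟩))
  have hpψ : ψ₀ p = m := hpmin
  have hp : p ∈ Ω := hmem p hpcl (by rw [hpψ]; exact hmin.ne)
  have hΓψ : ∀ x ∈ Γ, ψ₀ x = ψ₀ xsp := fun x hx => (hΓ hx).2
  have hΓΩ : Γ ⊆ Ω := fun x hx => hmem x (hΓ hx).1 (by rw [hΓψ x hx]; exact hsp.ne')
  have hΓc : IsClosed Γ := (isCompact_Icc.image_of_continuousOn hγ.1.continuousOn).isClosed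
  obtain ⟨M, hM⟩ := hbdd.isCompact_closure.exists_bound_of_continuousOn hψ.contOn
  obtain ⟨R, hR0, hR⟩ := hbdd.exists_pos_norm_le
  have hlow : ∀ h : ℝ, 0 < h → h ^ 2 / (4 * R ^ 2) * Real.exp (-(4 * M / h)) ≤
      LambdaD h (perpGrad ψ₀) B Ω := fun h hh => le_LambdaD hΩ ⟨p, hp⟩ hψ.c2 hψ.lap_eq hh
    (fun x hx => by simpa using hM x (subset_closure hx)) hR0 hR
  have hpos : ∀ h : ℝ, 0 < h → 0 < LambdaD h (perpGrad ψ₀) B Ω := fun h hh =>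
    lt_of_lt_of_le (by positivity) (hlow h hh)
  have hh0 : ∀ᶠ h : ℝ in 𝓝[>] 0, 0 < h := eventually_mem_nhdsWithin
  have hh1 : ∀ᶠ h : ℝ in 𝓝[>] 0, h < 1 := nhdsWithin_le_nhds (eventually_lt_nhds one_pos)
  have hcob : IsCoboundedUnder (· ≤ ·) (𝓝[>] (0 : ℝ))
      fun h : ℝ => h * Real.log (LambdaD h (perpGrad ψ₀) B Ω) := by
    have hlim : Tendsto (fun h : ℝ => 2 * (Real.log h * h) - h * Real.log (4 * R ^ 2))
        (𝓝[>] 0) (𝓝 0) := by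
      have h1 : Tendsto (fun h : ℝ => Real.log h * h) (𝓝[>] 0) (𝓝 0) := by
        simpa using tendsto_log_mul_rpow_nhdsGT_zero one_pos
      have h2 : Tendsto (fun h : ℝ => h * Real.log (4 * R ^ 2)) (𝓝[>] 0) (𝓝 0) := by
        simpa using (tendsto_nhdsWithin_of_tendsto_nhds tendsto_id).mul_const
          (Real.log (4 * R ^ 2)) (f := fun h : ℝ => h) (x := 𝓝[>] (0 : ℝ))
      simpa using (h1.const_mul 2).sub h2
    refine IsBoundedUnder.isCoboundedUnder_le ⟨-1 - 4 * M, eventually_map.2 ?_⟩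
    filter_upwards [hh0, hlim.eventually_const_lt (show (-1 : ℝ) < 0 by norm_num)] with h hh hl
    have h1 := Real.log_le_log (by positivity) (hlow h hh)
    rw [Real.log_mul (by positivity) (by positivity), Real.log_exp,
      Real.log_div (by positivity) (by positivity), Real.log_pow] at h1
    have h2 := mul_le_mul_of_nonneg_left h1 hh.le
    have h3 : h * (((2 : ℕ) : ℝ) * Real.log h - Real.log (4 * R ^ 2) + -(4 * M / h)) =
        2 * (Real.log h * h) - h * Real.log (4 * R ^ 2) - 4 * M := by
      field_simp
      push_cast
      ring
    linarith
  refine le_of_forall_pos_le_add fun e he => ?_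
  obtain ⟨v, hv, hc, hs, hva, hv1⟩ := exists_cutoff_of_mem_curveInterior (a := ψ₀ xsp - e / 8)
    hΩ hsc hψ.c2.continuousOn hΓc hΓΩ (fun x hx => by rw [hΓψ x hx]; linarith) hpint
  obtain ⟨C, hC, hup⟩ := exists_lambdaMinusD_le_exp (b := m + e / 8) hΩ hψ.c2 hψ.lap_eq hv hc hs
    hva hp hv1 (by rw [hpψ]; linarith)
  have hlim : Tendsto (fun h : ℝ => h * Real.log C) (𝓝[>] 0) (𝓝 0) := by
    simpa using (tendsto_nhdsWithin_of_tendsto_nhds tendsto_id).mul_const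
      (Real.log C) (f := fun h : ℝ => h) (x := 𝓝[>] (0 : ℝ))
  refine limsup_le_of_le hcob ?_
  filter_upwards [hh0, hh1, hlim.eventually_lt_const (half_pos he)] with h h0 h1 hl
  have h2 := Real.log_le_log (hpos h h0) ((min_le_left _ _).trans (hup h h0 h1))
  rw [Real.log_mul hC.ne' (by positivity), Real.log_exp] at h2
  have h3 := mul_le_mul_of_nonneg_left h2 h0.le
  have h4 : h * (Real.log C + -(2 * (ψ₀ xsp - e / 8 - (m + e / 8)) / h)) =
      h * Real.log C - 2 * (ψ₀ xsp - m) + e / 2 := by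
    field_simp
    ring
  linarith
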